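/- Let G be a finite bipartite graph with weight function w and let M be an MCM of G. If M is the unique solution to the SeqBAP for G, then M is also the unique solution to the LexBAP for G. -/

import Mathlib

open Finset

variable {V : Type*} [Fintype V] [DecidableEq V]

/-- `M` is a matching: no vertex is incident to more than one edge of `M`. -/
def IsMatching (M : Finset (Sym2 V)) : Prop :=
  ∀ v : V, (M.filter (fun e => v ∈ e)).card ≤ 1

/-- `M` is a maximum cardinality matching of the graph with edge set `E`. -/
def IsMCM (E M : Finset (Sym2 V)) : Prop :=
  M ⊆ E ∧ IsMatching M ∧ ∀ M' ⊆ E, IsMatching M' → M'.card ≤ M.card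

/-- The cardinality of a maximum cardinality matching of `E`. -/
noncomputable def mcmCard (E : Finset (Sym2 V)) : ℕ :=
  sSup {k : ℕ | ∃ M ⊆ E, IsMatching M ∧ M.card = k}

/-- The largest weight of an edge of `M` (`max_{e ∈ M} w(e)`). -/
noncomputable def maxW (w : Sym2 V → ℝ) (M : Finset (Sym2 V)) : ℝ :=
  sSup (w '' (M : Set (Sym2 V)))

/-- The bottleneck weight `W(G) = min over MCMs M of max_{e ∈ M} w(e)`. -/
noncomputable def botW (w : Sym2 V → ℝ) (E : Finset (Sym2 V)) : ℝ :=
  sInf (maxW w '' {M : Finset (Sym2 V) | IsMCM E M})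

/-- `M` is a bottleneck assignment of `E`. -/
def IsBotAssignment (w : Sym2 V → ℝ) (E M : Finset (Sym2 V)) : Prop :=
  IsMCM E M ∧ maxW w M = botW w E

/-- Edge `e` has strictly positive price of absence in `E`. -/
def PosPrice (w : Sym2 V → ℝ) (E : Finset (Sym2 V)) (e : Sym2 V) : Prop :=
  mcmCard (E.erase e) < mcmCard E ∨ botW w E < botW w (E.erase e)

/-- The price of absence `P(G,e)` as an extended real (`⊤` if removing `e`
reduces the MCM cardinality). -/
noncomputable def price (w : Sym2 V → ℝ) (E : Finset (Sym2 V)) (e : Sym2 V) : EReal :=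
  if mcmCard (E.erase e) < mcmCard E then ⊤
  else ((botW w (E.erase e) - botW w E : ℝ) : EReal)

/-- `E` is the edge set of a bipartite graph on disjoint parts `A` and `B`. -/
def IsBipartiteOn (A B : Finset V) (E : Finset (Sym2 V)) : Prop :=
  Disjoint A B ∧ ∀ e ∈ E, ∃ a ∈ A, ∃ b ∈ B, e = s(a, b)

/-- `P` is a path between `x` and `y` all of whose edges lie in `E`. -/
def IsPathBetween (E P : Finset (Sym2 V)) (x y : V) : Prop :=
  ∃ (l : ℕ) (v : Fin (l + 1) → V), 0 < l ∧ Function.Injective v ∧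
    v 0 = x ∧ v (Fin.last l) = y ∧
    (∀ k : Fin l, s(v k.castSucc, v k.succ) ∈ E) ∧
    P = Finset.image (fun k : Fin l => s(v k.castSucc, v k.succ)) Finset.univ

/-- `P` is alternating relative to the matching `M`. -/
def IsAlternating (M P : Finset (Sym2 V)) : Prop :=
  ∀ v : V, ((P ∩ M).filter (fun e => v ∈ e)).card ≤ 1 ∧
    ((P \ M).filter (fun e => v ∈ e)).card ≤ 1

/-- Vertex `v` is free relative to the matching `M`. -/
def IsFree (M : Finset (Sym2 V)) (v : V) : Prop := ∀ e ∈ M, v ∉ e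

/-- `P` is an augmenting path relative to `M` contained in the edge set `E`. -/
def IsAugPath (E M P : Finset (Sym2 V)) : Prop :=
  ∃ x y : V, IsPathBetween E P x y ∧ IsAlternating M P ∧ IsFree M x ∧ IsFree M y

/-- The matching-sublevel set `ψ(G,M)`. -/
noncomputable def sublevel (w : Sym2 V → ℝ) (E M : Finset (Sym2 V)) : Finset (Sym2 V) :=
  E.filter (fun e => w e ≤ maxW w M)

/-- The strict matching-sublevel set `ψ_S(G,M)`. -/
noncomputable def strictSublevel (w : Sym2 V → ℝ) (E M : Finset (Sym2 V)) : Finset (Sym2 V) :=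
  E.filter (fun e => w e < maxW w M)

/-- `ec` is a critical bottleneck edge of `E` relative to the MCM `M`. -/
noncomputable def IsCritical (w : Sym2 V → ℝ) (E M : Finset (Sym2 V)) (ec : Sym2 V) : Prop :=
  ec ∈ M ∧ (∀ e ∈ M, w e ≤ w ec) ∧
  ¬ ∃ P, IsAugPath ((M ∪ strictSublevel w E M).erase ec) (M.erase ec) P

/-- The set `L(M)` of maximum-weight edges of `M`. -/
noncomputable def maxEdges (w : Sym2 V → ℝ) (M : Finset (Sym2 V)) : Finset (Sym2 V) :=
  M.filter (fun e => ∀ e' ∈ M, w e' ≤ w e)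

/-- The edge set of the subgraph of `E` induced by agent set `Ak` and task set `Bk`. -/
def induced (E : Finset (Sym2 V)) (Ak Bk : Finset V) : Finset (Sym2 V) :=
  E.filter (fun e => ∃ a ∈ Ak, ∃ b ∈ Bk, e = s(a, b))

/-- Witness data of a solution to the SeqBAP: selected edges `{i_k, j_k}`,
vertex sets `A^k`, `B^k` (0-indexed) and bottleneck assignments `M^k` of the
induced graphs `G^k`. -/
structure SeqBAPData (w : Sym2 V → ℝ) (A B : Finset V) (E : Finset (Sym2 V)) (n : ℕ) where
  i : Fin n → V
  j : Fin n → V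
  Ak : Fin n → Finset V
  Bk : Fin n → Finset V
  Mk : Fin n → Finset (Sym2 V)
  hij : ∀ k, i k ∈ A ∧ j k ∈ B
  hedsitinct : ∀ k l, s(i k, j k) = s(i l, j l) → k = l
  hA0 : ∀ h : 0 < n, Ak ⟨0, h⟩ = A
  hB0 : ∀ h : 0 < n, Bk ⟨0, h⟩ = B
  hAk : ∀ (k : ℕ) (h : k + 1 < n),
    Ak ⟨k + 1, h⟩ = (Ak ⟨k, by omega⟩).erase (i ⟨k, by omega⟩)
  hBk : ∀ (k : ℕ) (h : k + 1 < n),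
    Bk ⟨k + 1, h⟩ = (Bk ⟨k, by omega⟩).erase (j ⟨k, by omega⟩)
  hMk : ∀ k, IsBotAssignment w (induced E (Ak k) (Bk k)) (Mk k)
  hmaxedge : ∀ k, s(i k, j k) ∈ maxEdges w (Mk k)
  hprice : ∀ k, ∀ e ∈ maxEdges w (Mk k),
    price w (induced E (Ak k) (Bk k)) e ≤ price w (induced E (Ak k) (Bk k)) (s(i k, j k))

/-- `M` is a solution to the SeqBAP for the bipartite graph with parts `A`, `B`
and edge set `E`. -/
def IsSeqBAPSol (w : Sym2 V → ℝ) (A B : Finset V) (E M : Finset (Sym2 V)) : Prop :=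
  IsMCM E M ∧ ∃ (n : ℕ) (d : SeqBAPData w A B E n),
    M.card = n ∧ M = Finset.image (fun k => s(d.i k, d.j k)) Finset.univ

/-- The weights of `M` sorted in nonincreasing order (the tuple `T(M)`). -/
noncomputable def sortedW (w : Sym2 V → ℝ) (M : Finset (Sym2 V)) : List ℝ :=
  ((M.val.map w).sort (· ≤ ·)).reverse

/-- The `k`-th entry `T_k(M)` (0-indexed) of the sorted weight tuple. -/
noncomputable def Tk (w : Sym2 V → ℝ) (M : Finset (Sym2 V)) (k : ℕ) : ℝ :=
  (sortedW w M).getD k 0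

/-- `M` is a solution to the LexBAP for the graph with edge set `E`. -/
def IsLexBAPSol (w : Sym2 V → ℝ) (E M : Finset (Sym2 V)) : Prop :=
  IsMCM E M ∧ ∀ M', IsMCM E M' → sortedW w M' ≠ sortedW w M →
    ∃ k < M.card, Tk w M k < Tk w M' k ∧ ∀ l < k, Tk w M l = Tk w M' l

lemma insert_lex_lt (a : ℝ) (l₁ l₂ : List ℝ) (h : l₁ < l₂) :
    l₁.orderedInsert (· ≥ ·) a < l₂.orderedInsert (· ≥ ·) a := by
  induction l₁ generalizing l₂ with
  | nil =>
    cases l₂ with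
    | nil => exact absurd h (lt_irrefl _)
    | cons y t =>
      simp only [List.orderedInsert]
      split_ifs with hy
      · exact List.cons_lt_cons_iff.2 (Or.inr ⟨rfl, h⟩)
      · exact List.cons_lt_cons_iff.2 (Or.inl (not_le.1 hy))
  | cons x s ih =>
    cases l₂ with
    | nil => exact absurd h (by simp)
    | cons y t =>
      have h' := List.cons_lt_cons_iff.1 h
      simp only [List.orderedInsert]
      split_ifs with hx hy hy
      · exact List.cons_lt_cons_iff.2 (Or.inr ⟨rfl, h⟩)
      · exact List.cons_lt_cons_iff.2 (Or.inl (not_le.1 hy))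
      · rcases h' with h' | ⟨rfl, h'⟩
        · exact absurd (h'.le.trans hy) hx
        · exact absurd hy hx
      · rcases h' with h' | ⟨rfl, h'⟩
        · exact List.cons_lt_cons_iff.2 (Or.inl h')
        · exact List.cons_lt_cons_iff.2 (Or.inr ⟨rfl, ih _ h'⟩)

lemma sortedW_eq (w : Sym2 V → ℝ) (M : Finset (Sym2 V)) :
    sortedW w M = (M.val.map w).sort (· ≥ ·) := by
  unfold sortedW
  apply List.Perm.eq_of_pairwise' (r := (· ≥ ·))
  · rw [List.pairwise_reverse]
    exact Multiset.pairwise_sort (M.val.map w) (· ≤ ·)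
  · exact Multiset.pairwise_sort _ _
  · refine (List.reverse_perm _).trans ?_
    rw [← Multiset.coe_eq_coe, Multiset.sort_eq, Multiset.sort_eq]

lemma sortedW_insert (w : Sym2 V → ℝ) (M : Finset (Sym2 V)) (e : Sym2 V) (he : e ∉ M) :
    sortedW w (insert e M) = (sortedW w M).orderedInsert (· ≥ ·) (w e) := by
  rw [sortedW_eq, sortedW_eq]
  apply List.Perm.eq_of_pairwise' (r := (· ≥ ·))
  · exact Multiset.pairwise_sort _ _
  · exact List.Pairwise.orderedInsert _ _ (Multiset.pairwise_sort _ _)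
  · refine List.Perm.trans ?_ (List.perm_orderedInsert _ _ _).symm
    rw [← Multiset.coe_eq_coe, Multiset.sort_eq, ← Multiset.cons_coe, Multiset.sort_eq,
      Finset.insert_val_of_notMem he, Multiset.map_cons]

lemma sortedW_length (w : Sym2 V → ℝ) (M : Finset (Sym2 V)) :
    (sortedW w M).length = M.card := by
  simp [sortedW]

lemma mem_sortedW (w : Sym2 V → ℝ) (M : Finset (Sym2 V)) (x : ℝ) :
    x ∈ sortedW w M ↔ ∃ e ∈ M, w e = x := by
  simp [sortedW]

lemma IsMCM.card_eq {E M N : Finset (Sym2 V)} (h : IsMCM E M) (h' : IsMCM E N) :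
    M.card = N.card :=
  le_antisymm (h'.2.2 _ h.1 h.2.1) (h.2.2 _ h'.1 h'.2.1)

/-- Lexicographic optimality in terms of the order on lists. -/
def IsLexMin (w : Sym2 V → ℝ) (E M : Finset (Sym2 V)) : Prop :=
  IsMCM E M ∧ ∀ N, IsMCM E N → sortedW w M ≤ sortedW w N

lemma lex_lt_iff (l₁ l₂ : List ℝ) (h : l₁.length = l₂.length) :
    l₁ < l₂ ↔ ∃ k < l₁.length, l₁.getD k 0 < l₂.getD k 0 ∧
      ∀ l < k, l₁.getD l 0 = l₂.getD l 0 := by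
  induction l₁ generalizing l₂ with
  | nil =>
    cases l₂ with
    | nil => simp
    | cons y t => simp at h
  | cons x s ih =>
    cases l₂ with
    | nil => simp at h
    | cons y t =>
      have hl : s.length = t.length := by simpa using h
      rw [List.cons_lt_cons_iff, ih t hl]
      constructor
      · rintro (h | ⟨rfl, k, hk, h1, h2⟩)
        · exact ⟨0, by simp, by simpa using h, by simp⟩
        · refine ⟨k + 1, by simpa using hk, by simpa using h1, ?_⟩
          intro l hl
          cases l with
          | zero => simp
          | succ l => simpa using h2 l (by omega)
      · rintro ⟨k, hk, h1, h2⟩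
        cases k with
        | zero => left; simpa using h1
        | succ k =>
          right
          refine ⟨by simpa using h2 0 (by omega), k, by simpa using hk, by simpa using h1, ?_⟩
          intro l hl
          simpa using h2 (l + 1) (by omega)

lemma isLexMin_iff (w : Sym2 V → ℝ) (E M : Finset (Sym2 V)) :
    IsLexMin w E M ↔ IsLexBAPSol w E M := by
  unfold IsLexMin IsLexBAPSol
  refine and_congr_right fun hM => forall_congr' fun N => ?_
  refine imp_congr_right fun hN => ?_
  have hl : (sortedW w M).length = (sortedW w N).length := by
    rw [sortedW_length, sortedW_length, hM.card_eq hN]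
  have := lex_lt_iff _ _ hl
  rw [sortedW_length] at this
  unfold Tk
  rw [← this, le_iff_lt_or_eq]
  constructor
  · rintro (h | h) hne
    · exact h
    · exact absurd h.symm hne
  · intro h
    by_cases he : sortedW w N = sortedW w M
    · exact Or.inr he.symm
    · exact Or.inl (h he)

lemma exists_isLexMin (w : Sym2 V → ℝ) (E M : Finset (Sym2 V)) (hM : IsMCM E M) :
    ∃ N, IsLexMin w E N := by
  obtain ⟨N, hN, h⟩ := Set.exists_min_image {N | IsMCM E N} (sortedW w) (Set.toFinite _) ⟨M, hM⟩
  exact ⟨N, hN, h⟩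

lemma maxW_le (w : Sym2 V → ℝ) {E M : Finset (Sym2 V)} (hM : IsLexMin w E M)
    (hne : M.Nonempty) (N : Finset (Sym2 V)) (hN : IsMCM E N) : maxW w M ≤ maxW w N := by
  have hNne : N.Nonempty := by
    rw [← Finset.card_pos, ← hM.1.card_eq hN]; exact hne.card_pos
  have hle := hM.2 N hN
  by_contra hlt
  rw [not_le] at hlt
  refine absurd hle (not_le.2 ?_)
  have hsM : (sortedW w M).Pairwise (· ≥ ·) := by
    rw [sortedW_eq]; exact Multiset.pairwise_sort _ _
  have lM := sortedW_length w M
  have lN := sortedW_length w N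
  have mM := mem_sortedW w M
  have mN := mem_sortedW w N
  cases hcM : sortedW w M with
  | nil => rw [hcM] at lM; have := hne.card_pos; simp at lM; omega
  | cons y t =>
    cases hcN : sortedW w N with
    | nil => rw [hcN] at lN; have := hNne.card_pos; simp at lN; omega
    | cons x s =>
      rw [hcM] at hsM mM
      rw [hcN] at mN
      refine List.cons_lt_cons_iff.2 (Or.inl ?_)
      have hx : x ≤ maxW w N := by
        obtain ⟨e, he, rfl⟩ := (mN x).1 (by simp)
        exact le_csSup (N.finite_toSet.image w).bddAbove ⟨e, he, rfl⟩
      have hy : maxW w M ≤ y := by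
        apply csSup_le (Set.Nonempty.image _ hne)
        rintro _ ⟨e, he, rfl⟩
        have := (mM (w e)).2 ⟨e, he, rfl⟩
        rcases List.mem_cons.1 this with h | h
        · exact h.le
        · exact (List.pairwise_cons.1 hsM).1 _ h
      linarith

lemma isBot_of_isLexMin (w : Sym2 V → ℝ) {E M : Finset (Sym2 V)} (hM : IsLexMin w E M)
    (hne : M.Nonempty) : IsBotAssignment w E M := by
  refine ⟨hM.1, ?_⟩
  have : IsLeast (maxW w '' {M : Finset (Sym2 V) | IsMCM E M}) (maxW w M) := by
    refine ⟨⟨M, hM.1, rfl⟩, ?_⟩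
    rintro _ ⟨N, hN, rfl⟩
    exact maxW_le w hM hne N hN
  exact this.csInf_eq.symm

lemma isMatching_iff (M : Finset (Sym2 V)) :
    IsMatching M ↔ ∀ v, ∀ e ∈ M, ∀ f ∈ M, v ∈ e → v ∈ f → e = f := by
  unfold IsMatching
  refine forall_congr' fun v => ?_
  rw [Finset.card_le_one]
  simp only [Finset.mem_filter]
  constructor
  · intro h e he f hf h1 h2
    exact h e ⟨he, h1⟩ f ⟨hf, h2⟩
  · rintro h e ⟨he, h1⟩ f ⟨hf, h2⟩
    exact h e he f hf h1 h2

lemma step (w : Sym2 V → ℝ) (E : Finset (Sym2 V)) (A B : Finset V) (hd : Disjoint A B)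
    (M : Finset (Sym2 V)) (hM : IsLexMin w (induced E A B) M) (a b : V) (ha : a ∈ A) (hb : b ∈ B)
    (he : s(a, b) ∈ M) :
    IsLexMin w (induced E (A.erase a) (B.erase b)) (M.erase s(a, b)) := by
  obtain ⟨⟨hsub, hmat, hmax⟩, hlex⟩ := hM
  have hmat' := (isMatching_iff M).1 hmat
  have hout : ∀ f ∈ induced E (A.erase a) (B.erase b), a ∉ f ∧ b ∉ f := by
    intro f hf
    obtain ⟨_, a', ha', b', hb', rfl⟩ := Finset.mem_filter.1 hf
    rw [Finset.mem_erase] at ha' hb'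
    have h1 : a ≠ b' := fun h => Finset.disjoint_left.1 hd ha (h ▸ hb'.2)
    have h2 : a' ≠ b := fun h => Finset.disjoint_left.1 hd ha'.2 (h ▸ hb)
    simp only [Sym2.mem_iff, not_or]
    exact ⟨⟨ha'.1.symm, h1⟩, h2.symm, hb'.1.symm⟩
  have hext : ∀ N ⊆ induced E (A.erase a) (B.erase b), IsMatching N →
      s(a, b) ∉ N ∧ insert s(a, b) N ⊆ induced E A B ∧ IsMatching (insert s(a, b) N) := by
    intro N hN hNm
    refine ⟨fun h => (hout _ (hN h)).1 (by simp), ?_, ?_⟩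
    · intro f hf
      rcases Finset.mem_insert.1 hf with rfl | hf
      · exact hsub he
      · obtain ⟨h0, a', ha', b', hb', rfl⟩ := Finset.mem_filter.1 (hN hf)
        exact Finset.mem_filter.2 ⟨h0, a', Finset.mem_of_mem_erase ha', b',
          Finset.mem_of_mem_erase hb', rfl⟩
    · have hNm' := (isMatching_iff N).1 hNm
      have key : ∀ v, ∀ f ∈ N, v ∈ f → v ∉ s(a, b) := by
        intro v f hf hv hvab
        rcases Sym2.mem_iff.1 hvab with rfl | rfl
        · exact (hout f (hN hf)).1 hv
        · exact (hout f (hN hf)).2 hv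
      rw [isMatching_iff]
      intro v e₁ h₁ e₂ h₂ hv₁ hv₂
      rcases Finset.mem_insert.1 h₁ with rfl | h₁ <;> rcases Finset.mem_insert.1 h₂ with rfl | h₂
      · rfl
      · exact absurd hv₁ (key v _ h₂ hv₂)
      · exact absurd hv₂ (key v _ h₁ hv₁)
      · exact hNm' v _ h₁ _ h₂ hv₁ hv₂
  have hcard : (M.erase s(a, b)).card + 1 = M.card := Finset.card_erase_add_one he
  have hmcm : IsMCM (induced E (A.erase a) (B.erase b)) (M.erase s(a, b)) := by
    refine ⟨?_, ?_, ?_⟩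
    · intro f hf
      obtain ⟨hne, hfM⟩ := Finset.mem_erase.1 hf
      obtain ⟨h0, a', ha', b', hb', rfl⟩ := Finset.mem_filter.1 (hsub hfM)
      refine Finset.mem_filter.2 ⟨h0, a', Finset.mem_erase.2 ⟨?_, ha'⟩, b',
        Finset.mem_erase.2 ⟨?_, hb'⟩, rfl⟩
      · rintro rfl
        exact hne (hmat' a' _ hfM _ he (by simp) (by simp))
      · rintro rfl
        exact hne (hmat' b' _ hfM _ he (by simp) (by simp))
    · rw [isMatching_iff]
      intro v e₁ h₁ e₂ h₂
      exact hmat' v _ (Finset.mem_of_mem_erase h₁) _ (Finset.mem_of_mem_erase h₂)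
    · intro N hN hNm
      obtain ⟨h1, h2, h3⟩ := hext N hN hNm
      have := hmax _ h2 h3
      rw [Finset.card_insert_of_notMem h1] at this
      omega
  refine ⟨hmcm, fun N hN => ?_⟩
  obtain ⟨h1, h2, h3⟩ := hext N hN.1 hN.2.1
  have hc := hmcm.card_eq hN
  have hins : IsMCM (induced E A B) (insert s(a, b) N) := by
    refine ⟨h2, h3, fun M' hM' hm' => ?_⟩
    have := hmax M' hM' hm'
    rw [Finset.card_insert_of_notMem h1]
    omega
  have hle := hlex _ hins
  by_contra hlt
  rw [not_le] at hlt
  have := insert_lex_lt (w s(a, b)) _ _ hlt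
  rw [← sortedW_insert w _ _ h1, ← sortedW_insert w _ _ (Finset.notMem_erase _ _),
    Finset.insert_erase he] at this
  exact absurd hle (not_le.2 this)

lemma exists_data (w : Sym2 V → ℝ) (E : Finset (Sym2 V)) (n : ℕ) :
    ∀ (A B : Finset V) (_ : Disjoint A B) (M : Finset (Sym2 V))
      (_ : IsLexMin w (induced E A B) M) (_ : M.card = n),
      ∃ d : SeqBAPData w A B E n,
        M = Finset.image (fun k => s(d.i k, d.j k)) Finset.univ := by
  induction n with
  | zero =>
    intro A B hd M hM hc
    refine ⟨⟨Fin.elim0, Fin.elim0, Fin.elim0, Fin.elim0, Fin.elim0, fun k => k.elim0,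
      fun k => k.elim0, fun h => absurd h (lt_irrefl _), fun h => absurd h (lt_irrefl _),
      fun k h => absurd h (by omega), fun k h => absurd h (by omega), fun k => k.elim0,
      fun k => k.elim0, fun k => k.elim0⟩, ?_⟩
    rw [Finset.card_eq_zero] at hc
    simp [hc]
  | succ n ih =>
    intro A B hd M hM hc
    have hne : M.Nonempty := by rw [← Finset.card_pos]; omega
    have hLne : (maxEdges w M).Nonempty := by
      obtain ⟨e, he, h⟩ := Finset.exists_max_image M w hne
      exact ⟨e, Finset.mem_filter.2 ⟨he, h⟩⟩
    obtain ⟨e, heL, hep⟩ := Finset.exists_max_image (maxEdges w M)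
      (price w (induced E A B)) hLne
    have heM : e ∈ M := (Finset.mem_filter.1 heL).1
    obtain ⟨_, a, ha, b, hb, rfl⟩ := Finset.mem_filter.1 (hM.1.1 heM)
    have hM' := step w E A B hd M hM a b ha hb heM
    have hd' : Disjoint (A.erase a) (B.erase b) :=
      hd.mono (Finset.erase_subset _ _) (Finset.erase_subset _ _)
    obtain ⟨d, hdM⟩ := ih _ _ hd' _ hM' (by
      have := Finset.card_erase_add_one heM
      omega)
    have hmem : ∀ k, s(d.i k, d.j k) ∈ M.erase s(a, b) := by
      intro k
      rw [hdM]
      exact Finset.mem_image_of_mem (fun k => s(d.i k, d.j k)) (Finset.mem_univ k)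
    have hneq : ∀ k, s(d.i k, d.j k) ≠ s(a, b) := fun k => Finset.ne_of_mem_erase (hmem k)
    refine ⟨{ i := Fin.cons a d.i, j := Fin.cons b d.j, Ak := Fin.cons A d.Ak
              Bk := Fin.cons B d.Bk, Mk := Fin.cons M d.Mk
              hij := ?_, hedsitinct := ?_, hA0 := ?_, hB0 := ?_, hAk := ?_, hBk := ?_
              hMk := ?_, hmaxedge := ?_, hprice := ?_ }, ?_⟩
    · intro k
      refine Fin.cases ?_ (fun k => ?_) k
      · exact ⟨ha, hb⟩
      · exact ⟨Finset.mem_of_mem_erase (d.hij k).1, Finset.mem_of_mem_erase (d.hij k).2⟩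
    · intro k l
      refine Fin.cases ?_ (fun k => ?_) k <;> refine Fin.cases ?_ (fun l => ?_) l
      · intro _; rfl
      · intro h; exact absurd h.symm (hneq l)
      · intro h; exact absurd h (hneq k)
      · intro h; exact congrArg Fin.succ (d.hedsitinct k l h)
    · intro h; rfl
    · intro h; rfl
    · intro k h
      cases k with
      | zero => exact d.hA0 (by omega)
      | succ k => exact d.hAk k (by omega)
    · intro k h
      cases k with
      | zero => exact d.hB0 (by omega)
      | succ k => exact d.hBk k (by omega)
    · intro k
      refine Fin.cases ?_ (fun k => ?_) k
      · exact isBot_of_isLexMin w hM hne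
      · exact d.hMk k
    · intro k
      refine Fin.cases ?_ (fun k => ?_) k
      · exact heL
      · exact d.hmaxedge k
    · intro k
      refine Fin.cases ?_ (fun k => ?_) k
      · exact hep
      · exact d.hprice k
    · have h1 : M = insert s(a, b) (M.erase s(a, b)) := (Finset.insert_erase heM).symm
      rw [hdM] at h1
      refine h1.trans ?_
      change _ = Finset.image (fun k : Fin (n + 1) =>
        s((Fin.cons a d.i : Fin (n + 1) → V) k, (Fin.cons b d.j : Fin (n + 1) → V) k)) Finset.univ
      ext f
      simp only [Finset.mem_insert, Finset.mem_image, Finset.mem_univ, true_and,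
        Fin.exists_fin_succ, Fin.cons_zero, Fin.cons_succ]
      exact or_congr_left eq_comm

/-- If `M` is the unique solution to the SeqBAP, then `M` is also the unique
solution to the LexBAP. -/
theorem unique_seqBAP_sol_is_unique_lexBAP_sol
    (A B : Finset V) (E : Finset (Sym2 V)) (w : Sym2 V → ℝ)
    (hbip : IsBipartiteOn A B E)
    (M : Finset (Sym2 V)) (hMCM : IsMCM E M)
    (hseq : IsSeqBAPSol w A B E M)
    (huniq : ∀ M' : Finset (Sym2 V), IsSeqBAPSol w A B E M' → M' = M) :
    IsLexBAPSol w E M ∧ ∀ M' : Finset (Sym2 V), IsLexBAPSol w E M' → M' = M := by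
  have hind : induced E A B = E := by
    refine Finset.filter_true_of_mem ?_
    exact hbip.2
  have key : ∀ N, IsLexMin w E N → N = M := by
    intro N hN
    refine huniq N ⟨hN.1, N.card, ?_⟩
    obtain ⟨d, hd⟩ := exists_data w E N.card A B hbip.1 N (by rw [hind]; exact hN) rfl
    exact ⟨d, rfl, hd⟩
  obtain ⟨N, hN⟩ := exists_isLexMin w E M hMCM
  refine ⟨?_, fun M' hM' => key M' ((isLexMin_iff w E M').2 hM')⟩
  have := key N hN
  subst this
  exact (isLexMin_iff w E N).1 hN
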